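/- Let n ∈ ℕ, let 0 ≤ t ≤ n and let k ∈ ℤ with |k| ≤ t and k ≡ t (mod 2). Then the probability that a random lattice path of length n passes through the point (t,k) equals 1/(t+1); i.e. (1/(n+1)) Σ_{ℓ=0}^{n} (1/C(n,ℓ)) · #{w ∈ P(n,ℓ) : s_t(w) = k} = 1/(t+1). If |k| > t or k ≢ t (mod 2), this probability is 0. -/

import Mathlib

/-- The step value of a lattice path: `true` is an up-step (+1), `false` a down-step (−1). -/
def pathStep (b : Bool) : ℤ := if b then 1 else -1

/-- Partial sum `s_t(w) = Σ_{i<t} w(i)` of a lattice path of length `n`. -/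
def psum {n : ℕ} (w : Fin n → Bool) (t : ℕ) : ℤ :=
  ∑ i ∈ Finset.univ.filter (fun i : Fin n => (i : ℕ) < t), pathStep (w i)

/-- `P(n,ℓ)`: lattice paths of length `n` with exactly `ℓ` down-steps. -/
def paths (n ℓ : ℕ) : Finset (Fin n → Bool) :=
  Finset.univ.filter (fun w => (Finset.univ.filter (fun i => w i = false)).card = ℓ)

/-- The number of down-steps of a lattice path. -/
def downCount {n : ℕ} (w : Fin n → Bool) : ℕ :=
  (Finset.univ.filter (fun i => w i = false)).card

/-- The probability of a single path in the random lattice path model. -/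
noncomputable def pathWeight {n : ℕ} (w : Fin n → Bool) : ℝ :=
  1 / (((n : ℝ) + 1) * (n.choose (downCount w) : ℝ))

theorem downCount_le {n : ℕ} (w : Fin n → Bool) : downCount w ≤ n := by
  simpa [downCount] using Finset.card_filter_le (Finset.univ : Finset (Fin n)) (fun i => w i = false)

theorem card_paths (n ℓ : ℕ) : (paths n ℓ).card = n.choose ℓ := by
  have h : (Finset.powersetCard ℓ (Finset.univ : Finset (Fin n))).card = n.choose ℓ := by simp
  rw [← h]
  refine Finset.card_nbij' (fun w => Finset.univ.filter (fun i => w i = false))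
    (fun s i => decide (i ∉ s)) ?_ ?_ ?_ ?_
  · intro w hw
    simpa [paths, Finset.mem_powersetCard] using hw
  · intro s hs
    simpa [paths, Finset.mem_powersetCard] using hs
  · intro w _
    ext i
    simp
  · intro s _
    ext i
    simp

theorem downCount_snoc {n : ℕ} (w : Fin n → Bool) (b : Bool) :
    downCount (Fin.snoc w b : Fin (n + 1) → Bool) = downCount w + if b = false then 1 else 0 := by
  simp only [downCount, Finset.card_filter, Fin.sum_univ_castSucc, Fin.snoc_castSucc,
    Fin.snoc_last]

theorem psum_snoc {n t : ℕ} (ht : t ≤ n) (w : Fin n → Bool) (b : Bool) :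
    psum (Fin.snoc w b : Fin (n + 1) → Bool) t = psum w t := by
  simp [psum, Finset.sum_filter, Fin.sum_univ_castSucc, ht]

theorem psum_self {n : ℕ} (w : Fin n → Bool) : psum w n = n - 2 * downCount w := by
  have h : ∀ b, pathStep b = 1 - 2 * (if b = false then 1 else 0) := by decide
  simp [psum, downCount, Finset.card_filter, h, Finset.sum_sub_distrib, -Finset.sum_boole,
    Finset.mul_sum]

theorem one_div_choose_add (n d : ℕ) (hd : d ≤ n) :
    1 / (((n : ℝ) + 1 + 1) * ((n + 1).choose d : ℝ))
      + 1 / (((n : ℝ) + 1 + 1) * ((n + 1).choose (d + 1) : ℝ))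
      = 1 / (((n : ℝ) + 1) * (n.choose d : ℝ)) := by
  obtain ⟨m, rfl⟩ := Nat.exists_eq_add_of_le hd
  have hc : ((d + m).choose d : ℝ) ≠ 0 := by
    exact_mod_cast (Nat.choose_pos hd).ne'
  have h1 : ((d + m + 1).choose (d + 1) : ℝ) = (d + m + 1) * (d + m).choose d / (d + 1) := by
    rw [eq_div_iff (by positivity)]
    exact_mod_cast (Nat.add_one_mul_choose_eq (d + m) d).symm
  have h2 : ((d + m + 1).choose d : ℝ) = (d + m + 1) * (d + m).choose d / (m + 1) := by
    rw [eq_div_iff (by positivity)]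
    have h := Nat.choose_mul_succ_eq (d + m) d
    rw [show d + m + 1 - d = m + 1 by omega] at h
    have h' : (((d + m).choose d * (d + m + 1) : ℕ) : ℝ)
        = ((d + m + 1).choose d * (m + 1) : ℕ) := congrArg _ h
    push_cast at h'
    linarith
  rw [h1, h2]
  push_cast
  field_simp
  ring

theorem pathWeight_snoc {n : ℕ} (w : Fin n → Bool) :
    pathWeight (Fin.snoc w true : Fin (n + 1) → Bool)
      + pathWeight (Fin.snoc w false : Fin (n + 1) → Bool) = pathWeight w := by
  simpa [pathWeight, downCount_snoc] using one_div_choose_add n (downCount w) (downCount_le w)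

theorem sum_pathWeight_succ {n t : ℕ} (ht : t ≤ n) (k : ℤ) :
    (∑ w : Fin (n + 1) → Bool, if psum w t = k then pathWeight w else 0)
      = ∑ w : Fin n → Bool, if psum w t = k then pathWeight w else 0 := by
  rw [← (Fin.snocEquiv (fun _ : Fin (n + 1) => Bool)).sum_comp, Fintype.sum_prod_type,
    Fintype.sum_bool, ← Finset.sum_add_distrib]
  refine Finset.sum_congr rfl fun w _ => ?_
  have h : ∀ b, Fin.snocEquiv (fun _ : Fin (n + 1) => Bool) (b, w) = Fin.snoc w b := fun _ => rfl
  simp only [h, psum_snoc ht]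
  split_ifs
  · exact pathWeight_snoc w
  · simp

theorem sum_pathWeight_eq {n t : ℕ} (ht : t ≤ n) (k : ℤ) :
    (∑ w : Fin n → Bool, if psum w t = k then pathWeight w else 0)
      = ∑ w : Fin t → Bool, if psum w t = k then pathWeight w else 0 := by
  induction n, ht using Nat.le_induction with
  | base => rfl
  | succ n hn ih => rw [sum_pathWeight_succ hn, ih]

theorem prob_eq_sum_pathWeight (n t : ℕ) (k : ℤ) :
    (1 / ((n : ℝ) + 1)) * ∑ ℓ ∈ Finset.range (n + 1),
        (1 / (n.choose ℓ : ℝ)) * (((paths n ℓ).filter (fun w => psum w t = k)).card : ℝ)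
      = ∑ w : Fin n → Bool, if psum w t = k then pathWeight w else 0 := by
  rw [← Finset.sum_fiberwise_of_maps_to (s := Finset.univ) (t := Finset.range (n + 1))
    (g := downCount) (fun w _ => Finset.mem_range.2 (Nat.lt_succ_of_le (downCount_le w))),
    Finset.mul_sum]
  refine Finset.sum_congr rfl fun ℓ _ => ?_
  have h : ∀ w ∈ Finset.univ.filter (fun w : Fin n → Bool => downCount w = ℓ),
      (if psum w t = k then pathWeight w else 0)
        = if psum w t = k then 1 / (((n : ℝ) + 1) * (n.choose ℓ : ℝ)) else 0 := by
    intro w hw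
    rw [pathWeight, (Finset.mem_filter.1 hw).2]
  rw [Finset.sum_congr rfl h, ← Finset.sum_filter, Finset.sum_const, nsmul_eq_mul,
    ← one_div_mul_one_div]
  change _ * (_ * (((Finset.univ.filter (fun w : Fin n → Bool => downCount w = ℓ)).filter
    (fun w => psum w t = k)).card : ℝ)) = _
  ring

/-- The probability that a random lattice path of length `n` passes through `(t,k)`
equals `1/(t+1)` when `|k| ≤ t` and `k ≡ t (mod 2)`, and `0` otherwise. -/
theorem prob_through_point (n t : ℕ) (ht : t ≤ n) (k : ℤ) :
    ((|k| ≤ (t : ℤ) ∧ (2 : ℤ) ∣ (k - (t : ℤ))) →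
      (1 / ((n : ℝ) + 1)) * ∑ ℓ ∈ Finset.range (n + 1),
        (1 / (n.choose ℓ : ℝ)) * (((paths n ℓ).filter (fun w => psum w t = k)).card : ℝ)
      = 1 / ((t : ℝ) + 1))
    ∧ (¬(|k| ≤ (t : ℤ) ∧ (2 : ℤ) ∣ (k - (t : ℤ))) →
      (1 / ((n : ℝ) + 1)) * ∑ ℓ ∈ Finset.range (n + 1),
        (1 / (n.choose ℓ : ℝ)) * (((paths n ℓ).filter (fun w => psum w t = k)).card : ℝ)
      = 0) := by
  rw [prob_eq_sum_pathWeight, sum_pathWeight_eq ht]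
  simp only [psum_self]
  constructor
  · rintro ⟨hk, c, hc⟩
    rw [abs_le] at hk
    obtain ⟨j, hj⟩ : ∃ j : ℕ, (j : ℤ) = -c := ⟨(-c).toNat, by omega⟩
    have hjt : j ≤ t := by omega
    have hiff : ∀ w : Fin t → Bool, (t : ℤ) - 2 * downCount w = k ↔ downCount w = j := by
      intro w
      omega
    have hw : ∀ w ∈ paths t j, pathWeight w = 1 / (((t : ℝ) + 1) * (t.choose j : ℝ)) := by
      intro w hw
      rw [pathWeight, show downCount w = j from (Finset.mem_filter.1 hw).2]
    have hc0 : (t.choose j : ℝ) ≠ 0 := by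
      exact_mod_cast (Nat.choose_pos hjt).ne'
    simp only [hiff]
    rw [← Finset.sum_filter]
    change ∑ w ∈ paths t j, pathWeight w = _
    rw [Finset.sum_congr rfl hw, Finset.sum_const, card_paths, nsmul_eq_mul]
    field_simp
  · intro h
    refine Finset.sum_eq_zero fun w _ => if_neg fun hw => h ?_
    have := downCount_le w
    exact ⟨abs_le.2 ⟨by omega, by omega⟩, by omega⟩
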